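/- arXiv:2603.10073 — 2 statements merged into one kernel-verified Lean document; each statement's English description precedes it below -/
import Mathlib

section
/- Fix c > 0 and π ∈ (0,1). Let δ = (1 + c²n)^{−1}, k = ⌊πn⌋, λ₀ = (1−π)/c², λ₁ = π/c². Let P_n be the law of A − B with A ~ Binomial(n−k, δ) and B ~ Binomial(k, δ) independent, P_∞ = Skellam(λ₀, λ₁), Q_n the law of 1 + A′ − B′ with A′ ~ Binomial(n−k−1, δ) and B′ ~ Binomial(k+1, δ) independent, and Q_∞ the law of 1 + D with D ~ Skellam(λ₀, λ₁). Then max{TV(P_n, P_∞), TV(Q_n, Q_∞)} ≤ (2c² + 3)/(c⁴ n). -/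
open MeasureTheory Filter

/-- Total variation distance `TV(μ,ν) = sup_A |μ(A) - ν(A)|`. -/
noncomputable def tvDist {Ω : Type*} [MeasurableSpace Ω] (μ ν : Measure Ω) : ℝ :=
  ⨆ A : {s : Set Ω // MeasurableSet s}, |(μ A.1).toReal - (ν A.1).toReal|

/-- Binomial(m,p) probability mass function on ℕ. -/
noncomputable def binomPMF (m : ℕ) (p : ℝ) (k : ℕ) : ℝ :=
  (m.choose k : ℝ) * p ^ k * (1 - p) ^ (m - k)

/-- Poisson(l) probability mass function on ℕ. -/
noncomputable def poisPMF (l : ℝ) (k : ℕ) : ℝ :=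
  Real.exp (-l) * l ^ k / (k.factorial : ℝ)

/-- pmf on ℤ of the difference `X - Y` of independent ℕ-valued variables with pmfs `f`, `g`. -/
noncomputable def diffPMF (f g : ℕ → ℝ) (d : ℤ) : ℝ :=
  ∑' q : ℕ × ℕ, if (q.1 : ℤ) - (q.2 : ℤ) = d then f q.1 * g q.2 else 0

/-- Skellam(l0,l1) pmf on ℤ: law of `X - Y`, `X ~ Poi(l0)`, `Y ~ Poi(l1)` independent. -/
noncomputable def skellamPMF (l0 l1 : ℝ) (d : ℤ) : ℝ :=
  diffPMF (poisPMF l0) (poisPMF l1) d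

/-- A probability mass function on the naturals. -/
def IsP (f : ℕ → ℝ) : Prop := (∀ n, 0 ≤ f n) ∧ HasSum f 1

/-- The `ℓ¹` distance. -/
noncomputable def dd (f g : ℕ → ℝ) : ℝ := ∑' n, |f n - g n|

/-- Convolution on the naturals. -/
noncomputable def cv (f g : ℕ → ℝ) (n : ℕ) : ℝ :=
  ∑ q ∈ Finset.HasAntidiagonal.antidiagonal n, f q.1 * g q.2

lemma IsP.sub_summable {f g : ℕ → ℝ} (hf : IsP f) (hg : IsP g) :
    Summable (fun n => |f n - g n|) :=
  (hf.2.summable.sub hg.2.summable).abs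

lemma dd_triangle {f g h : ℕ → ℝ} (hf : IsP f) (hg : IsP g) (hh : IsP h) :
    dd f h ≤ dd f g + dd g h := by
  unfold dd
  rw [← (hf.sub_summable hg).tsum_add (hg.sub_summable hh)]
  exact (hf.sub_summable hh).tsum_le_tsum (fun n => abs_sub_le _ _ _)
    ((hf.sub_summable hg).add (hg.sub_summable hh))

lemma dd_comm (f g : ℕ → ℝ) : dd f g = dd g f := by
  unfold dd
  congr 1; ext n; exact abs_sub_comm _ _

lemma cv_hasSum {f g : ℕ → ℝ} (hf : Summable f) (hg : Summable g)
    (_ : ∀ n, 0 ≤ f n) (_ : ∀ n, 0 ≤ g n) :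
    HasSum (cv f g) ((∑' n, f n) * ∑' n, g n) := by
  have h1 : Summable (fun n => ‖f n‖) := hf.norm
  have h2 : Summable (fun n => ‖g n‖) := hg.norm
  rw [tsum_mul_tsum_eq_tsum_sum_antidiagonal_of_summable_norm h1 h2]
  exact (summable_norm_sum_mul_antidiagonal_of_summable_norm h1 h2).of_norm.hasSum

lemma IsP.cv {f g : ℕ → ℝ} (hf : IsP f) (hg : IsP g) : IsP (cv f g) := by
  refine ⟨fun n => Finset.sum_nonneg fun q _ => mul_nonneg (hf.1 _) (hg.1 _), ?_⟩
  have := cv_hasSum hf.2.summable hg.2.summable hf.1 hg.1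
  rwa [hf.2.tsum_eq, hg.2.tsum_eq, one_mul] at this

lemma dd_cv {f g f' g' : ℕ → ℝ} (hf : IsP f) (hg : IsP g) (hf' : IsP f') (hg' : IsP g') :
    dd (cv f g) (cv f' g') ≤ dd f f' + dd g g' := by
  have h1 := cv_hasSum (hf.sub_summable hf') hg.2.summable (fun n => abs_nonneg _) hg.1
  have h2 := cv_hasSum hf'.2.summable (hg.sub_summable hg') hf'.1 (fun n => abs_nonneg _)
  rw [hg.2.tsum_eq, mul_one] at h1
  rw [hf'.2.tsum_eq, one_mul] at h2
  have h3 := h1.add h2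
  unfold dd at *
  rw [← h3.tsum_eq]
  refine ((hf.cv hg).sub_summable (hf'.cv hg')).tsum_le_tsum (fun n => ?_) h3.summable
  unfold cv
  rw [← Finset.sum_sub_distrib, ← Finset.sum_add_distrib]
  refine (Finset.abs_sum_le_sum_abs _ _).trans (Finset.sum_le_sum fun q _ => ?_)
  have : f q.1 * g q.2 - f' q.1 * g' q.2
      = (f q.1 - f' q.1) * g q.2 + f' q.1 * (g q.2 - g' q.2) := by ring
  rw [this]
  refine (abs_add_le _ _).trans ?_
  rw [abs_mul, abs_mul, abs_of_nonneg (hg.1 _), abs_of_nonneg (hf'.1 _)]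

lemma dd_self (f : ℕ → ℝ) : dd f f = 0 := by simp [dd]

lemma dd_le_single {f g : ℕ → ℝ} (hf : IsP f) (hg : IsP g) (j0 : ℕ) (e : ℝ)
    (h : ∀ j, |f j - g j| ≤ (g j - f j) + if j = j0 then 2 * e else 0) :
    dd f g ≤ 2 * e := by
  have h1 := (hg.2.sub hf.2).add (hasSum_ite_eq j0 (2 * e))
  have := hasSum_le h (hf.sub_summable hg).hasSum h1
  simpa [dd] using this

lemma isP_pois {a : ℝ} (ha : 0 ≤ a) : IsP (poisPMF a) := by
  refine ⟨fun n => by unfold poisPMF; positivity, ?_⟩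
  have h := (NormedSpace.expSeries_div_hasSum_exp (𝔸 := ℝ) a).mul_left (Real.exp (-a))
  rw [← Real.exp_eq_exp_ℝ, ← Real.exp_add, neg_add_cancel, Real.exp_zero] at h
  have e : poisPMF a = fun n => Real.exp (-a) * (a ^ n / (n.factorial : ℝ)) := by
    ext n; unfold poisPMF; ring
  rw [e]; exact h

lemma isP_binom (m : ℕ) {d : ℝ} (h0 : 0 ≤ d) (h1 : d ≤ 1) : IsP (binomPMF m d) := by
  have h1' : 0 ≤ 1 - d := by linarith
  refine ⟨fun n => by unfold binomPMF; positivity, ?_⟩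
  have h : HasSum (binomPMF m d) (∑ b ∈ Finset.range (m + 1), binomPMF m d b) :=
    hasSum_sum_of_ne_finset_zero (fun b hb => by
      have : m < b := by simpa using hb
      simp [binomPMF, Nat.choose_eq_zero_of_lt this])
  convert h using 1
  have := add_pow d (1 - d) m
  rw [show d + (1 - d) = 1 by ring, one_pow] at this
  rw [this]
  refine Finset.sum_congr rfl fun i _ => ?_
  unfold binomPMF; ring

lemma cv_pois (a b : ℝ) : cv (poisPMF a) (poisPMF b) = poisPMF (a + b) := by
  ext n
  unfold cv poisPMF
  rw [neg_add, Real.exp_add, (Commute.all a b).add_pow', Finset.mul_sum, Finset.sum_div]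
  refine Finset.sum_congr rfl fun q hq => ?_
  have hq' : q.1 + q.2 = n := by simpa using hq
  have h := Nat.add_choose_mul_factorial_mul_factorial q.1 q.2
  rw [← Nat.choose_symm_add, hq'] at h
  have h' : (n.choose q.1 : ℝ) * q.1.factorial * q.2.factorial = n.factorial := by
    exact_mod_cast h
  have e1 : (q.1.factorial : ℝ) ≠ 0 := by positivity
  have e2 : (q.2.factorial : ℝ) ≠ 0 := by positivity
  have e3 : (n.factorial : ℝ) ≠ 0 := by positivity
  rw [nsmul_eq_mul]
  field_simp
  rw [← h']
  ring

lemma cv_binom (m : ℕ) (d : ℝ) : cv (binomPMF m d) (binomPMF 1 d) = binomPMF (m + 1) d := by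
  ext n
  unfold cv
  rcases n with _ | n
  · simp [binomPMF, pow_succ]
  rw [Finset.Nat.sum_antidiagonal_succ', ]
  rcases n with _ | n
  · simp [binomPMF]
    rcases m with _ | m
    · simp
    · simp [pow_succ]; ring
  rw [Finset.Nat.sum_antidiagonal_succ']
  rw [Finset.sum_eq_zero]
  · simp only [binomPMF]
    rcases lt_trichotomy (n + 1) m with h | h | h
    · obtain ⟨r, rfl⟩ := Nat.exists_eq_add_of_lt h
      have e1 : n + 1 + r + 1 - (n + 1 + 1) = r := by omega
      have e2 : n + 1 + r + 1 - (n + 1) = r + 1 := by omega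
      have e3 : n + 1 + r + 1 + 1 - (n + 1 + 1) = r + 1 := by omega
      rw [e1, e2, e3, Nat.choose_succ_succ (n + 1 + r + 1) (n + 1)]
      simp; ring
    · subst h
      simp; ring
    · simp [Nat.choose_eq_zero_of_lt h, Nat.choose_eq_zero_of_lt (show m < n + 1 + 1 by omega),
        Nat.choose_eq_zero_of_lt (show m + 1 < n + 1 + 1 by omega)]
  · intro q _
    simp [binomPMF, Nat.choose_eq_zero_of_lt (show 1 < q.2 + 1 + 1 by omega)]

lemma dd_bern {d : ℝ} (h0 : 0 ≤ d) (h1 : d ≤ 1) : dd (binomPMF 1 d) (poisPMF d) ≤ 2 * d ^ 2 := by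
  have hd := Real.add_one_le_exp (-d)
  refine dd_le_single (isP_binom 1 h0 h1) (isP_pois h0) 1 _ fun j => ?_
  rcases j with _ | _ | j
  · simp [binomPMF, poisPMF]
    rw [abs_of_nonpos] <;> linarith
  · have hd2 : Real.exp (-d) ≤ 1 := Real.exp_le_one_iff.2 (by linarith)
    simp [binomPMF, poisPMF]
    rw [abs_of_nonneg] <;> nlinarith
  · have := (isP_pois h0).1 (j + 1 + 1)
    simp [binomPMF, Nat.choose_eq_zero_of_lt (show 1 < j + 1 + 1 by omega), abs_of_nonneg this]

lemma dd_pois_zero {t : ℝ} (h0 : 0 ≤ t) : dd (poisPMF 0) (poisPMF t) ≤ 2 * t := by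
  have hd := Real.add_one_le_exp (-t)
  have hd2 : Real.exp (-t) ≤ 1 := Real.exp_le_one_iff.2 (by linarith)
  refine dd_le_single (isP_pois le_rfl) (isP_pois h0) 0 _ fun j => ?_
  rcases j with _ | j
  · simp [poisPMF]
    rw [abs_of_nonneg] <;> linarith
  · have := (isP_pois h0).1 (j + 1)
    have h2 : poisPMF 0 (j + 1) = 0 := by simp [poisPMF]
    simp [h2, abs_of_nonneg this]

lemma dd_pois_le {a b : ℝ} (ha : 0 ≤ a) (h : a ≤ b) :
    dd (poisPMF a) (poisPMF b) ≤ 2 * (b - a) := by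
  have ht : 0 ≤ b - a := by linarith
  have := dd_cv (isP_pois ha) (isP_pois le_rfl) (isP_pois ha) (isP_pois ht)
  rw [cv_pois, cv_pois, dd_self, add_zero, add_sub_cancel, zero_add] at this
  exact this.trans (dd_pois_zero ht)

lemma dd_pois {a b : ℝ} (ha : 0 ≤ a) (hb : 0 ≤ b) :
    dd (poisPMF a) (poisPMF b) ≤ 2 * |a - b| := by
  rcases le_total a b with h | h
  · rw [abs_sub_comm, abs_of_nonneg (by linarith)]; exact dd_pois_le ha h
  · rw [dd_comm, abs_of_nonneg (by linarith)]; exact dd_pois_le hb h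

lemma dd_binom_pois (m : ℕ) {d : ℝ} (h0 : 0 ≤ d) (h1 : d ≤ 1) :
    dd (binomPMF m d) (poisPMF (m * d)) ≤ 2 * (m * d ^ 2) := by
  induction m with
  | zero =>
    have : binomPMF 0 d = poisPMF 0 := by
      ext n; rcases n with _ | n <;> simp [binomPMF, poisPMF]
    simp [this, dd_self]
  | succ m ih =>
    have := dd_cv (isP_binom m h0 h1) (isP_binom 1 h0 h1)
      (isP_pois (a := m * d) (by positivity)) (isP_pois h0)
    rw [cv_binom, cv_pois] at this
    have hb := dd_bern h0 h1
    have e : ((m + 1 : ℕ) : ℝ) * d = m * d + d := by push_cast; ring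
    rw [e]
    push_cast
    linarith

lemma dd_binom_pois' (m : ℕ) {d l : ℝ} (h0 : 0 ≤ d) (h1 : d ≤ 1) (hl : 0 ≤ l) :
    dd (binomPMF m d) (poisPMF l) ≤ 2 * (m * d ^ 2 + |m * d - l|) := by
  have hm : 0 ≤ m * d := by positivity
  have := dd_triangle (isP_binom m h0 h1) (isP_pois hm) (isP_pois hl)
  have h2 := dd_binom_pois m h0 h1
  have h3 := dd_pois hm hl
  linarith

/-- Fibrewise summation over the difference map. -/
lemma fiber_hasSum {h : ℕ × ℕ → ℝ} (hh : Summable h) :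
    (∀ d : ℤ, Summable fun q : ℕ × ℕ => if (q.1 : ℤ) - (q.2 : ℤ) = d then h q else 0) ∧
    HasSum (fun d : ℤ => ∑' q : ℕ × ℕ, if (q.1 : ℤ) - (q.2 : ℤ) = d then h q else 0)
      (∑' q, h q) := by
  let F : ℤ × (ℕ × ℕ) → ℝ := fun x => if (x.2.1 : ℤ) - (x.2.2 : ℤ) = x.1 then h x.2 else 0
  let i : ℕ × ℕ → ℤ × (ℕ × ℕ) := fun q => ((q.1 : ℤ) - (q.2 : ℤ), q)
  have hi : Function.Injective i := fun a b hab => (Prod.ext_iff.1 hab).2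
  have hF : HasSum F (∑' q, h q) := by
    rw [← hi.hasSum_iff]
    · have : F ∘ i = h := by ext q; simp [F, i]
      rw [this]; exact hh.hasSum
    · intro x hx
      simp only [F]
      rw [if_neg]
      intro he
      exact hx ⟨x.2, by ext <;> simp [i, he]⟩
  have hs : ∀ d : ℤ, Summable fun q : ℕ × ℕ =>
      if (q.1 : ℤ) - (q.2 : ℤ) = d then h q else 0 := fun d => hF.summable.prod_factor d
  exact ⟨hs, hF.prod_fiberwise fun d => (hs d).hasSum⟩

lemma prod_summable {f g : ℕ → ℝ} (hf : Summable f) (hg : Summable g) :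
    Summable (fun q : ℕ × ℕ => f q.1 * g q.2) :=
  summable_mul_of_summable_norm hf.norm hg.norm

lemma diff_l1 {f g f' g' : ℕ → ℝ} (hf : IsP f) (hg : IsP g) (hf' : IsP f') (hg' : IsP g') :
    Summable (fun d => |diffPMF f g d - diffPMF f' g' d|) ∧
    ∑' d, |diffPMF f g d - diffPMF f' g' d| ≤ dd f f' + dd g g' := by
  have s1 := prod_summable hf.2.summable hg.2.summable
  have s2 := prod_summable hf'.2.summable hg'.2.summable
  have s3 := (s1.sub s2).abs
  have t1 := prod_summable (hf.sub_summable hf') hg.2.summable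
  have t2 := prod_summable hf'.2.summable (hg.sub_summable hg')
  have F3 := fiber_hasSum s3
  have hle : ∀ d, |diffPMF f g d - diffPMF f' g' d| ≤
      ∑' q : ℕ × ℕ, if (q.1 : ℤ) - (q.2 : ℤ) = d then
        |f q.1 * g q.2 - f' q.1 * g' q.2| else 0 := by
    intro d
    unfold diffPMF
    rw [← ((fiber_hasSum s1).1 d).tsum_sub ((fiber_hasSum s2).1 d)]
    have e : (fun q : ℕ × ℕ => if (q.1 : ℤ) - (q.2 : ℤ) = d then
        |f q.1 * g q.2 - f' q.1 * g' q.2| else 0) = fun q : ℕ × ℕ =>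
        ‖(if (q.1 : ℤ) - (q.2 : ℤ) = d then f q.1 * g q.2 else 0)
          - (if (q.1 : ℤ) - (q.2 : ℤ) = d then f' q.1 * g' q.2 else 0)‖ := by
      ext q; split_ifs <;> simp
    have hs := F3.1 d
    rw [e] at hs ⊢
    exact norm_tsum_le_tsum_norm hs
  have hS := Summable.of_nonneg_of_le (fun d => abs_nonneg _) hle F3.2.summable
  refine ⟨hS, (hS.tsum_le_tsum hle F3.2.summable).trans ?_⟩
  rw [F3.2.tsum_eq]
  have e1 : dd f f' = ∑' q : ℕ × ℕ, |f q.1 - f' q.1| * g q.2 := by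
    rw [← tsum_mul_tsum_of_summable_norm (f := fun n => |f n - f' n|) (g := g)
      (hf.sub_summable hf').norm hg.2.summable.norm, hg.2.tsum_eq, mul_one]
    rfl
  have e2 : dd g g' = ∑' q : ℕ × ℕ, f' q.1 * |g q.2 - g' q.2| := by
    rw [← tsum_mul_tsum_of_summable_norm (f := f') (g := fun n => |g n - g' n|)
      hf'.2.summable.norm (hg.sub_summable hg').norm, hf'.2.tsum_eq, one_mul]
    rfl
  rw [e1, e2, ← t1.tsum_add t2]
  refine s3.tsum_le_tsum (fun q => ?_) (t1.add t2)
  have : f q.1 * g q.2 - f' q.1 * g' q.2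
      = (f q.1 - f' q.1) * g q.2 + f' q.1 * (g q.2 - g' q.2) := by ring
  rw [this]
  refine (abs_add_le _ _).trans ?_
  rw [abs_mul, abs_mul, abs_of_nonneg (hg.1 _), abs_of_nonneg (hf'.1 _)]

lemma diffPMF_nonneg {f g : ℕ → ℝ} (hf : IsP f) (hg : IsP g) (d : ℤ) : 0 ≤ diffPMF f g d := by
  unfold diffPMF
  refine tsum_nonneg fun q => ?_
  split_ifs
  · exact mul_nonneg (hf.1 _) (hg.1 _)
  · exact le_rfl

lemma measure_hasSum (μ : Measure ℤ) [IsProbabilityMeasure μ] (A : Set ℤ) :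
    HasSum (A.indicator fun d => (μ {d}).toReal) (μ A).toReal := by
  have h : μ A = ∑' d, A.indicator (fun d => μ {d}) d := by
    rw [Measure.tsum_indicator_apply_singleton _ _ (MeasurableSet.of_discrete)]
  have hne : ∑' d, A.indicator (fun d => μ {d}) d ≠ ⊤ := h ▸ measure_ne_top _ _
  have := ENNReal.hasSum_toReal hne
  rw [← ENNReal.tsum_toReal_eq (fun d => ENNReal.ne_top_of_tsum_ne_top hne d), ← h] at this
  convert this using 1
  ext d
  by_cases hd : d ∈ A <;> simp [hd]

lemma tv_le {f g f' g' : ℕ → ℝ} (hf : IsP f) (hg : IsP g) (hf' : IsP f') (hg' : IsP g')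
    (s : ℤ) (μ ν : Measure ℤ) [IsProbabilityMeasure μ] [IsProbabilityMeasure ν]
    (hμ : ∀ d, μ {d} = ENNReal.ofReal (diffPMF f g (d - s)))
    (hν : ∀ d, ν {d} = ENNReal.ofReal (diffPMF f' g' (d - s))) (E : ℝ)
    (hE : dd f f' + dd g g' ≤ 2 * E) : tvDist μ ν ≤ E := by
  obtain ⟨hS, hL⟩ := diff_l1 hf hg hf' hg'
  have hx : ∀ d, (μ {d}).toReal - (ν {d}).toReal
      = diffPMF f g (d - s) - diffPMF f' g' (d - s) := fun d => by
    rw [hμ, hν, ENNReal.toReal_ofReal (diffPMF_nonneg hf hg _),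
      ENNReal.toReal_ofReal (diffPMF_nonneg hf' hg' _)]
  have hX : HasSum (fun d => |(μ {d}).toReal - (ν {d}).toReal|)
      (∑' d, |diffPMF f g d - diffPMF f' g' d|) := by
    have := (Equiv.subRight s).hasSum_iff.2 hS.hasSum
    convert this using 1
    ext d; simp [hx]
  unfold tvDist
  haveI : Nonempty {s : Set ℤ // MeasurableSet s} := ⟨⟨∅, MeasurableSet.empty⟩⟩
  refine ciSup_le fun ⟨A, _⟩ => ?_
  have a1 := (measure_hasSum μ A).sub (measure_hasSum ν A)
  have a2 := (measure_hasSum μ Set.univ).sub (measure_hasSum ν Set.univ)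
  simp only [measure_univ, sub_self] at a2
  have b := (a1.mul_left 2).sub a2
  rw [sub_zero] at b
  have key : |2 * ((μ A).toReal - (ν A).toReal)| ≤
      ∑' d, |diffPMF f g d - diffPMF f' g' d| := by
    rw [abs_le]
    constructor
    · refine hasSum_le (fun d => ?_) hX.neg b
      have := abs_le.1 (le_refl |(μ {d}).toReal - (ν {d}).toReal|)
      by_cases hd : d ∈ A <;> simp [hd] <;> linarith
    · refine hasSum_le (fun d => ?_) b hX
      have := abs_le.1 (le_refl |(μ {d}).toReal - (ν {d}).toReal|)
      by_cases hd : d ∈ A <;> simp [hd] <;> linarith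
  rw [abs_mul, abs_two] at key
  show |(μ A).toReal - (ν A).toReal| ≤ E
  linarith

lemma final_bound (c p : ℝ) (hc : 0 < c) (hp0 : 0 < p) (hp1 : p < 1) (n k m : ℕ) (hn : 1 ≤ n)
    (hmk : m + k = n) (hk : |(k : ℝ) - p * n| ≤ 1) :
    dd (binomPMF m ((1 + c ^ 2 * n)⁻¹)) (poisPMF ((1 - p) / c ^ 2)) +
    dd (binomPMF k ((1 + c ^ 2 * n)⁻¹)) (poisPMF (p / c ^ 2)) ≤
      2 * ((2 * c ^ 2 + 3) / (c ^ 4 * n)) := by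
  have hn' : (1 : ℝ) ≤ n := by exact_mod_cast hn
  have hn0 : (0 : ℝ) < n := by linarith
  have hmk' : (m : ℝ) = n - k := by rw [← hmk]; push_cast; ring
  have hc2 : 0 < c ^ 2 := by positivity
  have hD : 0 < 1 + c ^ 2 * n := by positivity
  have h0 : 0 ≤ (1 + c ^ 2 * (n : ℝ))⁻¹ := by positivity
  have h1 : (1 + c ^ 2 * (n : ℝ))⁻¹ ≤ 1 := inv_le_one_of_one_le₀ (by nlinarith)
  have A := dd_binom_pois' m h0 h1 (l := (1 - p) / c ^ 2) (div_nonneg (by linarith) hc2.le)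
  have B := dd_binom_pois' k h0 h1 (l := p / c ^ 2) (by positivity)
  have hδ : (1 + c ^ 2 * (n : ℝ))⁻¹ ≤ 1 / (c ^ 2 * n) := by
    rw [inv_eq_one_div]; exact one_div_le_one_div_of_le (by positivity) (by linarith)
  have hδD : (1 + c ^ 2 * (n : ℝ))⁻¹ * (1 + c ^ 2 * n) = 1 := inv_mul_cancel₀ hD.ne'
  set δ := (1 + c ^ 2 * (n : ℝ))⁻¹ with hδdef
  have id1 : (m : ℝ) * δ - (1 - p) / c ^ 2 = -((1 - p) * (δ / c ^ 2)) - (k - p * n) * δ := by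
    rw [hmk']; field_simp; linear_combination (1 - p) * hδD
  have id2 : (k : ℝ) * δ - p / c ^ 2 = -(p * (δ / c ^ 2)) + (k - p * n) * δ := by
    field_simp; linear_combination p * hδD
  have hδc : 0 ≤ δ / c ^ 2 := by positivity
  have hkδ : |((k : ℝ) - p * n) * δ| ≤ δ := by
    rw [abs_mul, abs_of_nonneg h0]; nlinarith
  have kb := abs_le.1 hkδ
  have u1 : |(m : ℝ) * δ - (1 - p) / c ^ 2| ≤ (1 - p) * (δ / c ^ 2) + δ := by
    rw [id1, abs_le]
    have : 0 ≤ (1 - p) * (δ / c ^ 2) := mul_nonneg (by linarith) hδc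
    constructor <;> linarith
  have u2 : |(k : ℝ) * δ - p / c ^ 2| ≤ p * (δ / c ^ 2) + δ := by
    rw [id2, abs_le]
    have : 0 ≤ p * (δ / c ^ 2) := mul_nonneg (by linarith) hδc
    constructor <;> linarith
  have v1 : δ / c ^ 2 ≤ 1 / (c ^ 4 * n) := by
    calc δ / c ^ 2 ≤ 1 / (c ^ 2 * n) / c ^ 2 := by gcongr
      _ = 1 / (c ^ 4 * n) := by field_simp
  have v2 : (m : ℝ) * δ ^ 2 + k * δ ^ 2 ≤ 1 / (c ^ 4 * n) := by
    calc (m : ℝ) * δ ^ 2 + k * δ ^ 2 = n * δ ^ 2 := by rw [hmk']; ring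
      _ ≤ n * (1 / (c ^ 2 * n)) ^ 2 := by gcongr
      _ = 1 / (c ^ 4 * n) := by field_simp
  have w : (2 * c ^ 2 + 3) / (c ^ 4 * n) = 2 * (1 / (c ^ 2 * n)) + 3 * (1 / (c ^ 4 * n)) := by
    field_simp
  have w0 : 0 < 1 / (c ^ 4 * n) := by positivity
  rw [w]
  linarith

/-- Explicit `O(1/n)` rate for the Skellam-shift limit under the canonical calibration
`δ = (1+c²n)⁻¹`, `k = ⌊πn⌋`, `λ₀ = (1-π)/c²`, `λ₁ = π/c²`:
`max{TV(P_n,P_∞), TV(Q_n,Q_∞)} ≤ (2c²+3)/(c⁴n)`. -/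
theorem stmt9 (c p : ℝ) (hc : 0 < c) (hp0 : 0 < p) (hp1 : p < 1)
    (Pn Qn : ℕ → Measure ℤ) (Pinf Qinf : Measure ℤ)
    [∀ n, IsProbabilityMeasure (Pn n)] [∀ n, IsProbabilityMeasure (Qn n)]
    [IsProbabilityMeasure Pinf] [IsProbabilityMeasure Qinf]
    (hPn : ∀ n d, Pn n {d} = ENNReal.ofReal (diffPMF
      (binomPMF (n - Nat.floor (p * n)) ((1 + c ^ 2 * n)⁻¹))
      (binomPMF (Nat.floor (p * n)) ((1 + c ^ 2 * n)⁻¹)) d))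
    (hQn : ∀ n d, Qn n {d} = ENNReal.ofReal (diffPMF
      (binomPMF (n - Nat.floor (p * n) - 1) ((1 + c ^ 2 * n)⁻¹))
      (binomPMF (Nat.floor (p * n) + 1) ((1 + c ^ 2 * n)⁻¹)) (d - 1)))
    (hPinf : ∀ d, Pinf {d} = ENNReal.ofReal (skellamPMF ((1 - p) / c ^ 2) (p / c ^ 2) d))
    (hQinf : ∀ d, Qinf {d} = ENNReal.ofReal (skellamPMF ((1 - p) / c ^ 2) (p / c ^ 2) (d - 1))) :
    ∀ n : ℕ, 1 ≤ n →
      max (tvDist (Pn n) Pinf) (tvDist (Qn n) Qinf) ≤ (2 * c ^ 2 + 3) / (c ^ 4 * n) := by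
  intro n hn
  have hn0 : (1 : ℝ) ≤ n := by exact_mod_cast hn
  have hc2 : 0 < c ^ 2 := by positivity
  have hδ0 : 0 ≤ (1 + c ^ 2 * (n : ℝ))⁻¹ := by positivity
  have hδ1 : (1 + c ^ 2 * (n : ℝ))⁻¹ ≤ 1 := inv_le_one_of_one_le₀ (by nlinarith)
  have hl0 : 0 ≤ (1 - p) / c ^ 2 := div_nonneg (by linarith) hc2.le
  have hl1 : 0 ≤ p / c ^ 2 := by positivity
  have f1 := Nat.floor_le (show 0 ≤ p * (n : ℝ) by positivity)
  have f2 := Nat.lt_floor_add_one (p * (n : ℝ))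
  have f3 : Nat.floor (p * (n : ℝ)) < n := by
    rw [Nat.floor_lt (by positivity)]; nlinarith
  refine max_le ?_ ?_
  · refine tv_le (isP_binom _ hδ0 hδ1) (isP_binom _ hδ0 hδ1) (isP_pois hl0) (isP_pois hl1) 0
      (Pn n) Pinf (fun d => ?_) (fun d => ?_) _
      (final_bound c p hc hp0 hp1 n _ _ hn (Nat.sub_add_cancel f3.le) ?_)
    · rw [sub_zero]; exact hPn n d
    · rw [sub_zero]; exact hPinf d
    · rw [abs_le]; constructor <;> linarith
  · refine tv_le (isP_binom _ hδ0 hδ1) (isP_binom _ hδ0 hδ1) (isP_pois hl0) (isP_pois hl1) 1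
      (Qn n) Qinf (hQn n) hQinf _
      (final_bound c p hc hp0 hp1 n _ _ hn (by omega) ?_)
    push_cast
    rw [abs_le]; constructor <;> linarith
end

section
/- Fix c > 0 and π ∈ (0,1). Let δ_n = (1 + c²n)^{−1}, k_n = ⌊πn⌋, λ₀ = (1−π)/c², λ₁ = π/c². Let P_n be the law of A − B with A ~ Binomial(n−k_n, δ_n) and B ~ Binomial(k_n, δ_n) independent, and let P_∞ = Skellam(λ₀, λ₁). Then there exists N such that for all n ≥ N, (e^{−1/c²}/(4c⁴))·(1/n) ≤ TV(P_n, P_∞) ≤ ((2c² + 3)/c⁴)·(1/n); in particular TV(P_n, P_∞) = Θ(n^{−1}). The same two-sided bound holds for TV(Q_n, Q_∞), where Q_n is the law of 1 + A′ − B′ with A′ ~ Binomial(n−k_n−1, δ_n) and B′ ~ Binomial(k_n+1, δ_n) independent and Q_∞ is the law of 1 + D with D ~ Skellam(λ₀, λ₁). -/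
open MeasureTheory Filter

open ProbabilityTheory unitInterval in
lemma bin_succ (m : ℕ) (p : I) :
    ProbabilityTheory.binomial (m + 1) p
      = Measure.conv (ProbabilityTheory.binomial m p) (ProbabilityTheory.binomial 1 p) := by
  refine Measure.ext_of_measureReal_singleton fun k ↦ ?_
  rw [binomial_one_eq_bernoulliMeasure, bernoulliMeasure_def, Measure.conv_add,
    Measure.conv_comm, Measure.conv_comm _ (_ • Measure.dirac 0)]
  change _ = Measure.real (Measure.conv ((toNNReal p : ENNReal) • Measure.dirac 1) (binomial m p) +
    Measure.conv ((toNNReal (σ p) : ENNReal) • Measure.dirac 0) (binomial m p)) {k}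
  rw [Measure.conv_smul_left, Measure.conv_smul_left, Measure.dirac_zero_conv, Measure.dirac_conv,
    measureReal_add_apply (ENNReal.mul_ne_top (by simp) (measure_ne_top _ _))
      (ENNReal.mul_ne_top (by simp) (measure_ne_top _ _)), measureReal_ennreal_smul_apply, measureReal_ennreal_smul_apply,
    map_measureReal_apply (by fun_prop) (by simp)]
  rcases k with _ | k
  · have : (fun y : ℕ => 1 + y) ⁻¹' {0} = ∅ := by ext; simp
    rw [this]
    simp [binomial_real_singleton]
    ring
  · have : (fun y : ℕ => 1 + y) ⁻¹' {k+1} = {k} := by ext; simp; omega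
    rw [this]
    simp only [binomial_real_singleton, Nat.choose_succ_succ]
    rcases lt_trichotomy k m with h | h | h
    · obtain ⟨j, rfl⟩ := Nat.exists_eq_add_of_lt h
      have e1 : k + j + 1 + 1 - (k + 1) = j + 1 := by omega
      have e2 : k + j + 1 - k = j + 1 := by omega
      have e3 : k + j + 1 - (k + 1) = j := by omega
      rw [e1, e2, e3]
      push_cast
      simp
      ring
    · subst h
      simp
      ring
    · simp [Nat.choose_eq_zero_of_lt h, Nat.choose_eq_zero_of_lt (Nat.lt_succ_of_lt h)]

def Close {Ω : Type*} [MeasurableSpace Ω] (ε : ℝ) (μ ν : Measure Ω) : Prop :=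
  ∀ A, MeasurableSet A → |μ.real A - ν.real A| ≤ ε

lemma Close.symm' {Ω : Type*} [MeasurableSpace Ω] {ε : ℝ} {μ ν : Measure Ω} (h : Close ε μ ν) :
    Close ε ν μ := fun A hA => by rw [abs_sub_comm]; exact h A hA

lemma Close.trans' {Ω : Type*} [MeasurableSpace Ω] {ε δ : ℝ} {μ ν ρ : Measure Ω}
    (h : Close ε μ ν) (h2 : Close δ ν ρ) : Close (ε + δ) μ ρ := fun A hA =>
  (abs_sub_le _ (ν.real A) _).trans (add_le_add (h A hA) (h2 A hA))

lemma Close.map' {Ω Ω' : Type*} [MeasurableSpace Ω] [MeasurableSpace Ω'] {ε : ℝ}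
    {μ ν : Measure Ω} (h : Close ε μ ν) {f : Ω → Ω'} (hf : Measurable f) :
    Close ε (μ.map f) (ν.map f) := fun A hA => by
  rw [map_measureReal_apply hf hA, map_measureReal_apply hf hA]
  exact h _ (hf hA)

lemma real_prod_symm {Ω Ω' : Type*} [MeasurableSpace Ω] [MeasurableSpace Ω']
    (μ : Measure Ω) (ν : Measure Ω') [IsProbabilityMeasure μ] [IsProbabilityMeasure ν]
    {A : Set (Ω × Ω')} (hA : MeasurableSet A) :
    Integrable (fun y => μ.real ((fun x => (x, y)) ⁻¹' A)) ν ∧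
    (μ.prod ν).real A = ∫ y, μ.real ((fun x => (x, y)) ⁻¹' A) ∂ν := by
  have hm := measurable_measure_prodMk_right (μ := μ) hA
  constructor
  · refine Integrable.of_bound hm.ennreal_toReal.aestronglyMeasurable 1 ?_
    filter_upwards with y
    rw [Real.norm_of_nonneg (by positivity)]
    exact measureReal_le_one
  · rw [measureReal_def, Measure.prod_apply_symm hA]
    exact (integral_toReal hm.aemeasurable (by filter_upwards with y using measure_lt_top _ _)).symm

lemma Close.prod_left {Ω Ω' : Type*} [MeasurableSpace Ω] [MeasurableSpace Ω'] {ε : ℝ}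
    {μ μ' : Measure Ω} [IsProbabilityMeasure μ] [IsProbabilityMeasure μ']
    (h : Close ε μ μ') (ν : Measure Ω') [IsProbabilityMeasure ν] :
    Close ε (μ.prod ν) (μ'.prod ν) := fun A hA => by
  obtain ⟨i1, e1⟩ := real_prod_symm μ ν hA
  obtain ⟨i2, e2⟩ := real_prod_symm μ' ν hA
  rw [e1, e2, ← integral_sub i1 i2]
  have := norm_integral_le_of_norm_le_const (μ := ν) (C := ε)
    (f := fun y => μ.real ((fun x => (x, y)) ⁻¹' A) - μ'.real ((fun x => (x, y)) ⁻¹' A))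
    (by filter_upwards with y using h _ (measurable_prodMk_right hA))
  simpa using this

lemma Close.prod_right {Ω Ω' : Type*} [MeasurableSpace Ω] [MeasurableSpace Ω'] {ε : ℝ}
    {μ μ' : Measure Ω} [IsProbabilityMeasure μ] [IsProbabilityMeasure μ']
    (h : Close ε μ μ') (ν : Measure Ω') [IsProbabilityMeasure ν] :
    Close ε (ν.prod μ) (ν.prod μ') := by
  rw [← Measure.prod_swap, ← Measure.prod_swap (μ := μ')]
  exact (h.prod_left ν).map' measurable_swap

lemma Close.prod' {Ω Ω' : Type*} [MeasurableSpace Ω] [MeasurableSpace Ω'] {ε δ : ℝ}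
    {μ μ' : Measure Ω} [IsProbabilityMeasure μ] [IsProbabilityMeasure μ']
    {ν ν' : Measure Ω'} [IsProbabilityMeasure ν] [IsProbabilityMeasure ν']
    (h : Close ε μ μ') (h2 : Close δ ν ν') :
    Close (ε + δ) (μ.prod ν) (μ'.prod ν') :=
  (h.prod_left ν).trans' (h2.prod_right μ')

lemma Close.conv' {ε δ : ℝ}
    {μ μ' : Measure ℕ} [IsProbabilityMeasure μ] [IsProbabilityMeasure μ']
    {ν ν' : Measure ℕ} [IsProbabilityMeasure ν] [IsProbabilityMeasure ν']
    (h : Close ε μ μ') (h2 : Close δ ν ν') :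
    Close (ε + δ) (Measure.conv μ ν) (Measure.conv μ' ν') :=
  (h.prod' h2).map' (by fun_prop)

/-- one-point domination gives closeness -/
lemma close_of_dom {μ ν : Measure ℕ} [IsProbabilityMeasure μ] [IsProbabilityMeasure ν] {ε : ℝ}
    (hε : 0 ≤ ε) (a : ℕ) (ha : μ.real {a} ≤ ν.real {a} + ε)
    (h : ∀ k, k ≠ a → μ.real {k} ≤ ν.real {k}) : Close ε μ ν := by
  have key : ∀ A : Set ℕ, μ.real A ≤ ν.real A + ε := by
    intro A
    have hle : μ ≤ ν + ENNReal.ofReal ε • Measure.dirac a := by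
      refine Measure.le_iff.2 fun s hs => ?_
      rw [← Measure.tsum_indicator_apply_singleton _ s hs,
        ← Measure.tsum_indicator_apply_singleton _ s hs]
      refine ENNReal.tsum_le_tsum fun k => Set.indicator_le_indicator ?_
      rw [Measure.add_apply, ← ofReal_measureReal (μ := μ), ← ofReal_measureReal (μ := ν)]
      by_cases hk : k = a
      · subst hk
        simp only [Measure.smul_apply, Measure.dirac_apply, smul_eq_mul]
        simp only [Set.indicator_of_mem (Set.mem_singleton k), Pi.one_apply, mul_one]
        rw [← ENNReal.ofReal_add (by positivity) hε]
        exact ENNReal.ofReal_le_ofReal ha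
      · exact (ENNReal.ofReal_le_ofReal (h k hk)).trans le_self_add
    have h1 := hle A
    rw [Measure.add_apply] at h1
    have h2 : μ A ≤ ν A + ENNReal.ofReal ε := h1.trans (by
      gcongr
      rw [Measure.smul_apply, smul_eq_mul]
      exact mul_le_of_le_one_right' prob_le_one)
    rw [measureReal_def, measureReal_def]
    have := ENNReal.toReal_mono (by finiteness) h2
    rwa [ENNReal.toReal_add (by finiteness) (by finiteness), ENNReal.toReal_ofReal hε] at this
  intro A hA
  have h1 := key A
  have h2 := key Aᶜ
  rw [probReal_compl_eq_one_sub hA, probReal_compl_eq_one_sub hA] at h2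
  rw [abs_le]
  constructor <;> linarith

open ProbabilityTheory unitInterval in
lemma ber_pois (p : I) : Close ((p : ℝ) ^ 2) (binomial 1 p) (poissonMeasure (toNNReal p)) := by
  have hp := p.2
  have he := Real.add_one_le_exp (-(p : ℝ))
  refine close_of_dom (sq_nonneg _) 1 ?_ ?_
  · rw [binomial_real_singleton, poissonMeasure_real_singleton]
    simp
    nlinarith [hp.1]
  · intro k hk
    rw [binomial_real_singleton, poissonMeasure_real_singleton]
    rcases k with _ | _ | k
    · simp
      linarith
    · simp at hk
    · rw [Nat.choose_eq_zero_of_lt (by omega)]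
      simp only [Nat.cast_zero, zero_mul]
      positivity

open ProbabilityTheory unitInterval in
lemma bin_pois (m : ℕ) (p : I) :
    Close (m * (p : ℝ) ^ 2) (binomial m p) (poissonMeasure (m * toNNReal p)) := by
  induction m with
  | zero =>
    have : binomial 0 p = poissonMeasure ((0 : ℕ) * toNNReal p) := by
      refine Measure.ext_of_measureReal_singleton fun k ↦ ?_
      rw [binomial_real_singleton, poissonMeasure_real_singleton]
      rcases k with _ | k <;> simp
    rw [this]
    intro A _
    simp
  | succ m ih =>
    rw [bin_succ]
    have : ((m + 1 : ℕ) : NNReal) * toNNReal p = m * toNNReal p + toNNReal p := by push_cast; ring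
    rw [this, ← poissonMeasure_conv_poissonMeasure]
    have := ih.conv' (ber_pois p)
    convert this using 1
    push_cast; ring

open ProbabilityTheory in
lemma pois_pois_add (a s : NNReal) : Close (s : ℝ) (poissonMeasure a) (poissonMeasure (a + s)) := by
  have h0 : Close (s : ℝ) (poissonMeasure 0) (poissonMeasure s) := by
    have he := Real.add_one_le_exp (-(s : ℝ))
    refine close_of_dom s.2 0 ?_ ?_
    · rw [poissonMeasure_real_singleton, poissonMeasure_real_singleton]
      simp
      linarith
    · intro k hk
      rw [poissonMeasure_real_singleton, poissonMeasure_real_singleton]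
      simp [hk]
      positivity
  have h1 : Close 0 (poissonMeasure a) (poissonMeasure a) := fun A _ => by simp
  have := h1.conv' h0
  rwa [poissonMeasure_conv_poissonMeasure, poissonMeasure_conv_poissonMeasure, add_zero,
    zero_add] at this

open ProbabilityTheory in
lemma pois_pois (a b : NNReal) : Close |(a : ℝ) - b| (poissonMeasure a) (poissonMeasure b) := by
  rcases le_total a b with h | h
  · obtain ⟨s, rfl⟩ := exists_add_of_le h
    have := pois_pois_add a s
    simpa using this
  · obtain ⟨s, rfl⟩ := exists_add_of_le h
    have := (pois_pois_add b s).symm'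
    simpa using this

lemma hasSum_real_indicator {Ω : Type*} [Countable Ω] [MeasurableSpace Ω]
    [MeasurableSingletonClass Ω] (μ : Measure Ω) [IsProbabilityMeasure μ]
    (A : Set Ω) : HasSum (A.indicator (fun d => μ.real {d})) (μ.real A) := by
  have h := Measure.tsum_indicator_apply_singleton μ A A.to_countable.measurableSet
  have h2 := ENNReal.hasSum_toReal (f := A.indicator (fun d => μ {d}))
    (by rw [h]; exact measure_ne_top _ _)
  rw [← ENNReal.tsum_toReal_eq, h] at h2
  · rw [measureReal_def]
    convert h2 using 1
    ext d
    by_cases hd : d ∈ A <;> simp [hd, measureReal_def]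
  · intro d
    by_cases hd : d ∈ A <;> simp [hd]

lemma le_tvDist (μ ν : Measure ℤ) [IsProbabilityMeasure μ] [IsProbabilityMeasure ν]
    (A : Set ℤ) : |μ.real A - ν.real A| ≤ tvDist μ ν := by
  have hb : BddAbove (Set.range fun A : {s : Set ℤ // MeasurableSet s} =>
      |(μ A.1).toReal - (ν A.1).toReal|) := by
    refine ⟨1, ?_⟩
    rintro _ ⟨B, rfl⟩
    have h1 : (μ B.1).toReal ≤ 1 := measureReal_le_one (μ := μ)
    have h2 : (ν B.1).toReal ≤ 1 := measureReal_le_one (μ := ν)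
    have h3 : 0 ≤ (μ B.1).toReal := ENNReal.toReal_nonneg
    have h4 : 0 ≤ (ν B.1).toReal := ENNReal.toReal_nonneg
    simp only [abs_le]
    constructor <;> linarith
  exact le_ciSup hb ⟨A, A.to_countable.measurableSet⟩

lemma norm_integral_sub_le (μ ν : Measure ℤ) [IsProbabilityMeasure μ] [IsProbabilityMeasure ν]
    (f : ℤ → ℂ) (hf : ∀ d, ‖f d‖ ≤ 1) :
    ‖∫ d, f d ∂μ - ∫ d, f d ∂ν‖ ≤ 2 * tvDist μ ν := by
  have hiμ : Integrable f μ := Integrable.of_bound (by fun_prop) 1 (by filter_upwards with d using hf d)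
  have hiν : Integrable f ν := Integrable.of_bound (by fun_prop) 1 (by filter_upwards with d using hf d)
  have sμ := hasSum_real_indicator μ
  have sν := hasSum_real_indicator ν
  have aμ : Summable (fun d => μ.real {d} • f d) := by
    refine Summable.of_norm_bounded (g := fun d => μ.real {d}) (by simpa using (sμ Set.univ).summable) ?_
    intro d
    rw [norm_smul, Real.norm_of_nonneg (by positivity)]
    exact mul_le_of_le_one_right (by positivity) (hf d)
  have aν : Summable (fun d => ν.real {d} • f d) := by
    refine Summable.of_norm_bounded (g := fun d => ν.real {d}) (by simpa using (sν Set.univ).summable) ?_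
    intro d
    rw [norm_smul, Real.norm_of_nonneg (by positivity)]
    exact mul_le_of_le_one_right (by positivity) (hf d)
  rw [integral_countable hiμ, integral_countable hiν, ← aμ.tsum_sub aν]
  set A : Set ℤ := {d | 0 ≤ μ.real {d} - ν.real {d}} with hA
  have hs := ((sμ A).sub (sν A)).sub ((sμ Aᶜ).sub (sν Aᶜ))
  have h1 := le_tvDist μ ν A
  have h2 := le_tvDist μ ν Aᶜ
  have := tsum_of_norm_bounded hs (f := fun d => μ.real {d} • f d - ν.real {d} • f d) ?_
  · refine this.trans ?_
    have h3 := le_abs_self (μ.real A - ν.real A)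
    have h4 := neg_abs_le (μ.real Aᶜ - ν.real Aᶜ)
    linarith
  · intro d
    rw [← sub_smul, norm_smul]
    refine (mul_le_of_le_one_right (norm_nonneg _) (hf d)).trans ?_
    rw [Real.norm_eq_abs]
    by_cases hd : d ∈ A
    · have : 0 ≤ μ.real {d} - ν.real {d} := hd
      simp [hd, abs_of_nonneg this]
    · have : ¬ 0 ≤ μ.real {d} - ν.real {d} := hd
      have h' := (not_le.1 this).le
      simp [hd, abs_of_nonpos h']

noncomputable def diffLaw (μ ν : Measure ℕ) (e : ℤ) : Measure ℤ :=
  (μ.prod ν).map (fun q => (q.1 : ℤ) - (q.2 : ℤ) + e)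

lemma law_eq (R : Measure ℤ) [IsProbabilityMeasure R] (μ ν : Measure ℕ)
    [IsProbabilityMeasure μ] [IsProbabilityMeasure ν] (f g : ℕ → ℝ)
    (hf : ∀ k, μ.real {k} = f k) (hg : ∀ k, ν.real {k} = g k) (e : ℤ)
    (hR : ∀ d, R {d} = ENNReal.ofReal (diffPMF f g (d - e))) : R = diffLaw μ ν e := by
  have : IsProbabilityMeasure (diffLaw μ ν e) :=
    Measure.isProbabilityMeasure_map (by fun_prop)
  refine Measure.ext_of_singleton fun d => ?_
  rw [hR, ← ofReal_measureReal (μ := diffLaw μ ν e)]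
  congr 1
  rw [diffLaw, map_measureReal_apply (by fun_prop) (by simp), diffPMF,
    ← (hasSum_real_indicator (μ.prod ν) _).tsum_eq]
  refine tsum_congr fun q => ?_
  have h1 : (μ.prod ν).real {q} = f q.1 * g q.2 := by
    rw [← hf, ← hg, ← measureReal_prod_prod]
    congr 1
    ext; simp [Prod.ext_iff]
  classical
  rw [Set.indicator_apply, h1]
  refine if_congr ?_ rfl rfl
  simp only [Set.mem_preimage, Set.mem_singleton_iff]
  omega

lemma integral_diffLaw (μ ν : Measure ℕ) [IsProbabilityMeasure μ] [IsProbabilityMeasure ν]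
    (e : ℤ) : ‖∫ d, Complex.I ^ d ∂(diffLaw μ ν e)‖
      = ‖∫ k, Complex.I ^ k ∂μ‖ * ‖∫ k, (-Complex.I) ^ k ∂ν‖ := by
  rw [diffLaw, integral_map (by fun_prop) (by fun_prop)]
  have : ∀ q : ℕ × ℕ, Complex.I ^ ((q.1 : ℤ) - (q.2 : ℤ) + e)
      = (Complex.I ^ q.1 * (-Complex.I) ^ q.2) * Complex.I ^ e := by
    intro q
    rw [zpow_add₀ Complex.I_ne_zero, zpow_sub₀ Complex.I_ne_zero, ← Complex.inv_I, inv_pow]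
    simp [div_eq_mul_inv]
  simp_rw [this]
  rw [integral_mul_const, norm_mul, integral_prod_mul (fun k : ℕ => Complex.I ^ k)
    (fun k : ℕ => (-Complex.I) ^ k), norm_mul, norm_zpow]
  simp

open ProbabilityTheory unitInterval in
lemma integral_bin (m : ℕ) (p : I) (z : ℂ) :
    ∫ k, z ^ k ∂(binomial m p) = ((p : ℝ) * z + (1 - (p : ℝ))) ^ m := by
  rw [integral_binomial, add_pow]
  have : Finset.Iic m = Finset.range (m + 1) := by ext; simp
  rw [this]
  refine Finset.sum_congr rfl fun k _ => ?_
  rw [Complex.real_smul]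
  push_cast
  ring

open ProbabilityTheory in
lemma integral_pois (r : NNReal) (z : ℂ) :
    ∫ k, z ^ k ∂(poissonMeasure r) = Complex.exp (r * (z - 1)) := by
  rw [integral_poissonMeasure]
  have h := (NormedSpace.expSeries_div_hasSum_exp ((r : ℂ) * z)).mul_left (Complex.exp (-r))
  rw [← Complex.exp_eq_exp_ℂ, ← Complex.exp_add] at h
  have e : (r : ℂ) * (z - 1) = -r + r * z := by ring
  rw [e, ← h.tsum_eq]
  refine tsum_congr fun k => ?_
  rw [Complex.real_smul]
  push_cast
  ring

open ProbabilityTheory unitInterval in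
lemma norm_bin (m m' : ℕ) (p : I) (e : ℤ) :
    ‖∫ d, Complex.I ^ d ∂(diffLaw (binomial m p) (binomial m' p) e)‖ ^ 2
      = ((p : ℝ) ^ 2 + (1 - p) ^ 2) ^ (m + m') := by
  rw [integral_diffLaw, integral_bin, integral_bin, norm_pow, norm_pow]
  have h1 : ‖((p : ℝ) : ℂ) * Complex.I + (1 - (p : ℝ))‖ ^ 2 = (p : ℝ) ^ 2 + (1 - p) ^ 2 := by
    rw [Complex.sq_norm, Complex.normSq_apply]
    simp
    ring
  have h2 : ‖((p : ℝ) : ℂ) * (-Complex.I) + (1 - (p : ℝ))‖ ^ 2 = (p : ℝ) ^ 2 + (1 - p) ^ 2 := by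
    rw [Complex.sq_norm, Complex.normSq_apply]
    simp
    ring
  rw [mul_pow, ← pow_mul, ← pow_mul, mul_comm m, mul_comm m', pow_mul, pow_mul, h1, h2, pow_add]

open ProbabilityTheory in
lemma norm_pois (a b : NNReal) (e : ℤ) :
    ‖∫ d, Complex.I ^ d ∂(diffLaw (poissonMeasure a) (poissonMeasure b) e)‖
      = Real.exp (-(a + b)) := by
  rw [integral_diffLaw, integral_pois, integral_pois, Complex.norm_exp, Complex.norm_exp,
    ← Real.exp_add]
  congr 1
  simp
  ring

lemma key_ineq (x : ℝ) (h0 : 0 ≤ x) (h1 : x ≤ 1) :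
    Real.exp (-2 * x + x ^ 2) ≤ (1 + x ^ 2) / (1 + x) ^ 2 := by
  have hy : 0 ≤ 2 * x - x ^ 2 := by nlinarith
  have := Real.quadratic_le_exp_of_nonneg hy
  have e : -2 * x + x ^ 2 = -(2 * x - x ^ 2) := by ring
  rw [e, Real.exp_neg, le_div_iff₀ (by positivity), inv_mul_le_iff₀ (Real.exp_pos _)]
  have h2 : (1 + x) ^ 2 ≤ (1 + (2 * x - x ^ 2) + (2 * x - x ^ 2) ^ 2 / 2) * (1 + x ^ 2) := by
    have : (1 + (2 * x - x ^ 2) + (2 * x - x ^ 2) ^ 2 / 2) * (1 + x ^ 2) - (1 + x) ^ 2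
      = x ^ 2 * (1 + x ^ 2 * (3 / 2 - 2 * x + x ^ 2 / 2)) := by ring
    have h3 : 0 ≤ x ^ 2 * (1 + x ^ 2 * (3 / 2 - 2 * x + x ^ 2 / 2)) := by
      have : 0 ≤ 3 / 2 - 2 * x + x ^ 2 / 2 := by nlinarith
      positivity
    linarith
  exact h2.trans (by gcongr)

open ProbabilityTheory unitInterval in
lemma core (c p θ : ℝ) (hc : 0 < c) (hp0 : 0 < p) (hp1 : p < 1) (n m1 m2 : ℕ) (hn : 0 < n)
    (hnc : 1 / c ^ 2 ≤ n) (h1 : (m1 : ℝ) = (1 - p) * n + θ) (h2 : (m2 : ℝ) = p * n - θ)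
    (hθ : |θ| ≤ 1) (e : ℤ) (R S : Measure ℤ) [IsProbabilityMeasure R] [IsProbabilityMeasure S]
    (hR : ∀ d, R {d} = ENNReal.ofReal (diffPMF (binomPMF m1 ((1 + c ^ 2 * n)⁻¹))
      (binomPMF m2 ((1 + c ^ 2 * n)⁻¹)) (d - e)))
    (hS : ∀ d, S {d} = ENNReal.ofReal (skellamPMF ((1 - p) / c ^ 2) (p / c ^ 2) (d - e))) :
    (Real.exp (-(c ^ 2)⁻¹) / (4 * c ^ 4)) * (1 / n) ≤ tvDist R S
        ∧ tvDist R S ≤ ((2 * c ^ 2 + 3) / c ^ 4) * (1 / n) := by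
  have hn' : (0 : ℝ) < n := by exact_mod_cast hn
  obtain ⟨t, ht⟩ : ∃ t, t = 1 / c ^ 2 := ⟨_, rfl⟩
  have ht0 : 0 < t := by rw [ht]; positivity
  rw [← ht] at hnc
  have hδ : (1 + c ^ 2 * n)⁻¹ = t / (n + t) := by rw [ht]; field_simp; ring
  have eS1 : (1 - p) / c ^ 2 = (1 - p) * t := by rw [ht]; ring
  have eS2 : p / c ^ 2 = p * t := by rw [ht]; ring
  have el : (Real.exp (-(c ^ 2)⁻¹) / (4 * c ^ 4)) * (1 / n) = Real.exp (-t) * t ^ 2 / (4 * n) := by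
    rw [ht, one_div (c ^ 2)]; field_simp
  have eu : ((2 * c ^ 2 + 3) / c ^ 4) * (1 / n) = (2 * t + 3 * t ^ 2) / n := by
    rw [ht]; field_simp
  rw [hδ] at hR
  rw [eS1, eS2] at hS
  rw [el, eu]
  have hδI : t / (n + t) ∈ I := ⟨by positivity, by rw [div_le_one (by positivity)]; linarith⟩
  obtain ⟨δ, hδd⟩ : ∃ δ : I, (δ : ℝ) = t / (n + t) := ⟨⟨_, hδI⟩, rfl⟩
  have hp1' : 0 < 1 - p := by linarith
  obtain ⟨a, ha⟩ : ∃ a : NNReal, (a : ℝ) = (1 - p) * t := ⟨⟨(1 - p) * t, by positivity⟩, rfl⟩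
  obtain ⟨b, hb⟩ : ∃ b : NNReal, (b : ℝ) = p * t := ⟨⟨p * t, by positivity⟩, rfl⟩
  have lR := law_eq R (binomial m1 δ) (binomial m2 δ) _ _
    (fun k => by rw [binomial_real_singleton, hδd]; rfl)
    (fun k => by rw [binomial_real_singleton, hδd]; rfl) e hR
  have lS := law_eq S (poissonMeasure a) (poissonMeasure b) _ _
    (fun k => by rw [poissonMeasure_real_singleton, ha]; rfl)
    (fun k => by rw [poissonMeasure_real_singleton, hb]; rfl) e hS
  have hnt : (n : ℝ) + t ≠ 0 := by positivity
  constructor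
  · have hT := norm_integral_sub_le R S (fun d => Complex.I ^ d) (fun d => by simp)
    have hT2 := (norm_sub_norm_le _ _).trans hT
    have nS : ‖∫ d, Complex.I ^ d ∂S‖ = Real.exp (-t) := by
      rw [lS, norm_pois, ha, hb]; congr 1; ring
    have nR : (Real.exp (-t) * Real.exp (t ^ 2 / (2 * n))) ^ 2 ≤
        ‖∫ d, (Complex.I ^ d : ℂ) ∂(R)‖ ^ 2 := by
      rw [lR, norm_bin, hδd]
      have hm : m1 + m2 = n := by
        have : (m1 : ℝ) + m2 = n := by rw [h1, h2]; ring
        exact_mod_cast this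
      rw [hm]
      have hx := key_ineq (t / n) (by positivity) (by rw [div_le_one hn']; exact hnc)
      have e1 : (t / (n + t)) ^ 2 + (1 - t / (n + t)) ^ 2
          = (1 + (t / n) ^ 2) / (1 + t / n) ^ 2 := by
        field_simp
        ring
      rw [e1]
      refine le_trans (le_of_eq ?_) (pow_le_pow_left₀ (Real.exp_pos _).le hx n)
      rw [← Real.exp_add, ← Real.exp_nat_mul, ← Real.exp_nat_mul]
      congr 1
      push_cast
      field_simp
    have nR' := (pow_le_pow_iff_left₀ (by positivity) (norm_nonneg _) two_ne_zero).1 nR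
    have hexp := Real.add_one_le_exp (t ^ 2 / (2 * n))
    have := mul_le_mul_of_nonneg_left hexp (Real.exp_pos (-t)).le
    rw [nS] at hT2
    have e3 : Real.exp (-t) * t ^ 2 / (4 * n) = (Real.exp (-t) * (t ^ 2 / (2 * n) + 1) - Real.exp (-t)) / 2 := by
      field_simp
      ring
    rw [e3]
    linarith
  · have c1 := (bin_pois m1 δ).trans' (pois_pois _ a)
    have c2 := (bin_pois m2 δ).trans' (pois_pois _ b)
    have cc := (c1.prod' c2).map' (f := fun q => (q.1 : ℤ) - (q.2 : ℤ) + e) (by fun_prop)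
    have hle : m1 * (δ : ℝ) ^ 2 + |((m1 * toNNReal δ : NNReal) : ℝ) - a| + (m2 * (δ : ℝ) ^ 2 +
        |((m2 * toNNReal δ : NNReal) : ℝ) - b|) ≤ (2 * t + 3 * t ^ 2) / n := by
      push_cast
      rw [ha, hb, coe_toNNReal, hδd]
      have hθ' := abs_le.1 hθ
      have b1 : |(m1 : ℝ) * (t / (n + t)) - (1 - p) * t| ≤ t * (1 + (1 - p) * t) / n := by
        have : (m1 : ℝ) * (t / (n + t)) - (1 - p) * t = t * (θ - (1 - p) * t) / (n + t) := by
          rw [h1]; field_simp; ring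
        rw [this, abs_div, abs_mul, abs_of_pos ht0, abs_of_pos (by positivity : (0:ℝ) < n + t)]
        have hq : 0 < (1 - p) * t := by positivity
        have : |θ - (1 - p) * t| ≤ 1 + (1 - p) * t := by
          rw [abs_le]; constructor <;> linarith
        gcongr
        linarith
      have b2 : |(m2 : ℝ) * (t / (n + t)) - p * t| ≤ t * (1 + p * t) / n := by
        have : (m2 : ℝ) * (t / (n + t)) - p * t = t * (-θ - p * t) / (n + t) := by
          rw [h2]; field_simp; ring
        rw [this, abs_div, abs_mul, abs_of_pos ht0, abs_of_pos (by positivity : (0:ℝ) < n + t)]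
        have hq : 0 < p * t := by positivity
        have : |-θ - p * t| ≤ 1 + p * t := by
          rw [abs_le]; constructor <;> linarith
        gcongr
        linarith
      have b3 : (m1 : ℝ) * (t / (n + t)) ^ 2 + m2 * (t / (n + t)) ^ 2 ≤ t ^ 2 / n := by
        have : (m1 : ℝ) * (t / (n + t)) ^ 2 + m2 * (t / (n + t)) ^ 2 = n * (t / (n + t)) ^ 2 := by
          rw [h1, h2]; ring
        rw [this]
        calc n * (t / (n + t)) ^ 2 ≤ n * (t / n) ^ 2 := by gcongr; linarith
          _ = t ^ 2 / n := by field_simp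
      have b4 : t * (1 + (1 - p) * t) / n + t * (1 + p * t) / n + t ^ 2 / n + t ^ 2 / n
        = (2 * t + 3 * t ^ 2) / n := by ring
      have b5 : 0 ≤ t ^ 2 / n := by positivity
      linarith
    have : Nonempty {s : Set ℤ // MeasurableSet s} := ⟨⟨∅, .empty⟩⟩
    refine ciSup_le fun A => ?_
    rw [lR, lS]
    exact (cc A.1 A.2).trans hle

/-- Sharp `n⁻¹` total-variation rate in the canonical Skellam regime:
eventually `(e^{-1/c²}/(4c⁴))/n ≤ TV(P_n,P_∞) ≤ ((2c²+3)/c⁴)/n`, and the same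
two-sided bound holds for `TV(Q_n,Q_∞)`. -/
theorem stmt10 (c p : ℝ) (hc : 0 < c) (hp0 : 0 < p) (hp1 : p < 1)
    (Pn Qn : ℕ → Measure ℤ) (Pinf Qinf : Measure ℤ)
    [∀ n, IsProbabilityMeasure (Pn n)] [∀ n, IsProbabilityMeasure (Qn n)]
    [IsProbabilityMeasure Pinf] [IsProbabilityMeasure Qinf]
    (hPn : ∀ n d, Pn n {d} = ENNReal.ofReal (diffPMF
      (binomPMF (n - Nat.floor (p * n)) ((1 + c ^ 2 * n)⁻¹))
      (binomPMF (Nat.floor (p * n)) ((1 + c ^ 2 * n)⁻¹)) d))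
    (hQn : ∀ n d, Qn n {d} = ENNReal.ofReal (diffPMF
      (binomPMF (n - Nat.floor (p * n) - 1) ((1 + c ^ 2 * n)⁻¹))
      (binomPMF (Nat.floor (p * n) + 1) ((1 + c ^ 2 * n)⁻¹)) (d - 1)))
    (hPinf : ∀ d, Pinf {d} = ENNReal.ofReal (skellamPMF ((1 - p) / c ^ 2) (p / c ^ 2) d))
    (hQinf : ∀ d, Qinf {d} = ENNReal.ofReal (skellamPMF ((1 - p) / c ^ 2) (p / c ^ 2) (d - 1))) :
    ∃ N : ℕ, ∀ n : ℕ, N ≤ n →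
      ((Real.exp (-(c ^ 2)⁻¹) / (4 * c ^ 4)) * (1 / n) ≤ tvDist (Pn n) Pinf
        ∧ tvDist (Pn n) Pinf ≤ ((2 * c ^ 2 + 3) / c ^ 4) * (1 / n))
      ∧ ((Real.exp (-(c ^ 2)⁻¹) / (4 * c ^ 4)) * (1 / n) ≤ tvDist (Qn n) Qinf
        ∧ tvDist (Qn n) Qinf ≤ ((2 * c ^ 2 + 3) / c ^ 4) * (1 / n)) := by
  refine ⟨⌈1 / c ^ 2⌉₊ + 1, fun n hN => ?_⟩
  have hn : 0 < n := by omega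
  have hn' : (0 : ℝ) < n := by exact_mod_cast hn
  have hnc : 1 / c ^ 2 ≤ n := (Nat.le_ceil _).trans (by exact_mod_cast (by omega))
  have hfl := Nat.floor_le (a := p * n) (by positivity)
  have hfl2 := Nat.lt_floor_add_one (p * n)
  have hlt : Nat.floor (p * n) + 1 ≤ n := by
    have : (Nat.floor (p * n) : ℝ) < n := hfl.trans_lt (by nlinarith)
    exact_mod_cast this
  constructor
  · refine core c p (p * n - Nat.floor (p * n)) hc hp0 hp1 n _ _ hn hnc ?_ ?_ ?_ 0 _ _
      (fun d => by rw [sub_zero]; exact hPn n d) (fun d => by rw [sub_zero]; exact hPinf d)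
    · rw [Nat.cast_sub (by omega)]; ring
    · ring
    · rw [abs_le]; constructor <;> linarith
  · refine core c p (p * n - Nat.floor (p * n) - 1) hc hp0 hp1 n _ _ hn hnc ?_ ?_ ?_ 1 _ _
      (hQn n) hQinf
    · rw [Nat.sub_sub, Nat.cast_sub hlt]; push_cast; ring
    · push_cast; ring
    · rw [abs_le]; constructor <;> linarith
end
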